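/- arXiv:2003.05160 — 4 statements merged into one kernel-verified Lean document; each statement's English description precedes it below -/
import Mathlib

section
/- Let τ1 be the mixed-criticality task with period T1 = 15, level-1 budget 3, level-2 budget 7 and deadline 15, and τ2 the task with period T2 = 2, level-1 budget 1, level-2 budget 1 and deadline 2 (both of criticality level 2). Then (a) the level-2 utilization satisfies 7/15 + 1/2 < 1, so the set is schedulable by reserving full level-2 budgets; yet (b) for every choice of integer virtual level-1 deadlines d1 with 3 ≤ d1 ≤ 15 and d2 with 1 ≤ d2 ≤ 2 (the level-2 virtual deadlines being the full deadlines 15 and 2), there exists a positive integer e such that either dbf_1^{τ1}(e) + dbf_1^{τ2}(e) > e or dbf_SM^{τ1}(e) + dbf_SM^{τ2}(e) > e; i.e., the single-mode demand-bound-function schedulability test fails for every virtual deadline assignment. -/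
/-- `x mod T`: the remainder of `x` upon division by `T`, lying in `[0, T)`. -/
noncomputable def rmod (x T : ℝ) : ℝ := x - T * (⌊x / T⌋ : ℤ)

/-- The lowest-mode (level-1) demand bound function of a task with period `T`,
level-1 budget `C1` and level-1 virtual relative deadline `D1`. -/
noncomputable def dbfOne (T C1 D1 e : ℝ) : ℝ :=
  if D1 ≤ e then (((⌊(e - D1) / T⌋ : ℤ) : ℝ) + 1) * C1 else 0

/-- The demand of the carry-over job that must be finished before the mode switch. -/
noncomputable def doneSM (T C1 C2 D1 D2 e : ℝ) : ℝ :=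
  if D2 - D1 ≤ rmod e T ∧ rmod e T < D2 then max 0 (C1 - rmod e T + D2 - D1) else 0

/-- The single-mode (SM) demand bound function for level-2 mode of a task with
period `T`, budgets `C1 ≤ C2` and virtual relative deadlines `D1 ≤ D2`. -/
noncomputable def dbfSM (T C1 C2 D1 D2 e : ℝ) : ℝ :=
  max 0 ((((⌊(e - (D2 - D1)) / T⌋ : ℤ) : ℝ) + 1) * C2) - doneSM T C1 C2 D1 D2 e

/-- For τ₁ = (T=15, C¹=3, C²=7, D=15) and τ₂ = (T=2, C¹=1, C²=1, D=2):
(a) the level-2 utilization is below 1, yet (b) for every integer choice of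
level-1 virtual deadlines the single-mode dbf schedulability test fails. -/
theorem example_task_set_reservation_schedulable_but_SM_test_fails :
    ((7 : ℝ) / 15 + 1 / 2 < 1) ∧
    (∀ d1 d2 : ℤ, 3 ≤ d1 → d1 ≤ 15 → 1 ≤ d2 → d2 ≤ 2 →
      ∃ e : ℕ, 0 < e ∧
        (dbfOne 15 3 (d1 : ℝ) (e : ℝ) + dbfOne 2 1 (d2 : ℝ) (e : ℝ) > (e : ℝ) ∨
         dbfSM 15 3 7 (d1 : ℝ) 15 (e : ℝ) + dbfSM 2 1 1 (d2 : ℝ) 2 (e : ℝ) > (e : ℝ))) := by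
  refine ⟨by norm_num, fun d1 d2 h3 h15 h1 h2 => ?_⟩
  obtain rfl | rfl : d2 = 1 ∨ d2 = 2 := by omega
  · rcases le_or_gt d1 5 with h | h
    · refine ⟨5, by norm_num, Or.inl ?_⟩
      interval_cases d1 <;> norm_num [dbfOne]
    · refine ⟨12, by norm_num, Or.inr ?_⟩
      interval_cases d1 <;> norm_num [dbfSM, doneSM, rmod]
  · rcases le_or_gt d1 4 with h | h
    · refine ⟨4, by norm_num, Or.inl ?_⟩
      interval_cases d1 <;> norm_num [dbfOne]
    · refine ⟨13, by norm_num, Or.inr ?_⟩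
      interval_cases d1 <;> norm_num [dbfSM, doneSM, rmod]
end

section
/- (Case C1 of the level-(m−1) maximum demand pattern.) If e ≤ D'', then for every r ∈ [−T, 0], DEM(r) ≤ DEM(((e − D'') mod T) − T); that is, when the interval length does not exceed the level-(m−1) virtual deadline, the demand is maximized by aligning the carry-over job's level-(m−1) virtual deadline with the end of the interval. -/
/-- Demand in `[0, e)` of the carry-over job `J^A` (active at the switch into
level-(m−1) mode at time 0) of a level-(m−1) task, released at time `r`. -/
noncomputable def Adem (C' C'' D' D'' e S r : ℝ) : ℝ :=
  if 0 ≤ r + D' ∧ r + D'' ≤ e then min (min (r + D') C' + C'' - C') S else 0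

/-- Demand in `[0, e)` of the carry-over job `J^B` (active at the switch into
level-m mode at time `S`) of a level-(m−1) task, released at time `s`. -/
noncomputable def Bdem (C'' D'' e S s : ℝ) : ℝ :=
  if s + D'' ≤ e then min C'' (S - s) else 0

/-- Total demand of a level-(m−1) task in `[0, e)` when its carry-over job `J^A`
is released at time `r` and all subsequent jobs are released as early as
possible (every `T` time units). -/
noncomputable def DEM (T C' C'' D' D'' e S r : ℝ) : ℝ :=
  if S < r + T then Adem C' C'' D' D'' e S r
  else Adem C' C'' D' D'' e S r
    + ((⌊(S - r - T) / T⌋ : ℤ) : ℝ) * C''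
    + Bdem C'' D'' e S (r + (((⌊(S - r - T) / T⌋ : ℤ) : ℝ) + 1) * T)

theorem rmod_eq_add_of_neg {x T : ℝ} (hx : -T ≤ x) (hx0 : x < 0) : rmod x T = x + T := by
  have hT : 0 < T := by linarith
  have h : ⌊x / T⌋ = -1 := by
    rw [Int.floor_eq_iff]
    push_cast
    constructor
    · rw [le_div_iff₀ hT]; linarith
    · rw [div_lt_iff₀ hT]; linarith
  simp [rmod, h]

theorem Adem_nonneg {C' C'' D' D'' e S r : ℝ} (hC : C' ≤ C'') (hC' : 0 ≤ C') (hS : 0 ≤ S) :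
    0 ≤ Adem C' C'' D' D'' e S r := by
  unfold Adem
  split_ifs with h
  · have : 0 ≤ min (r + D') C' := le_min h.1 hC'
    exact le_min (by linarith) hS
  · exact le_rfl

theorem Adem_le_min {C' C'' D' D'' e S r : ℝ} (hC'' : 0 ≤ C'') (hS : 0 ≤ S) :
    Adem C' C'' D' D'' e S r ≤ min C'' S := by
  unfold Adem
  split_ifs
  · refine min_le_min_right S ?_
    linarith [min_le_right (r + D') C']
  · exact le_min hC'' hS

/-- The carry-over demand is largest when the level-(m−1) deadline is at the end of the
interval. -/
theorem Adem_le_Adem_aligned {C' C'' D' D'' e S r : ℝ} (hC : C' ≤ C'') (hC' : 0 ≤ C')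
    (hS : 0 ≤ S) : Adem C' C'' D' D'' e S r ≤ Adem C' C'' D' D'' e S (e - D'') := by
  by_cases h : 0 ≤ r + D' ∧ r + D'' ≤ e
  · have h' : 0 ≤ e - D'' + D' ∧ e - D'' + D'' ≤ e := ⟨by linarith, by linarith⟩
    rw [Adem, Adem, if_pos h, if_pos h']
    have : r ≤ e - D'' := by linarith
    gcongr
  · rw [Adem, if_neg h]
    exact Adem_nonneg hC hC' hS

/-- If the second job has its deadline after the end of the interval, and the third is released
after the switch into level-m mode, only the carry-over job contributes. -/
theorem DEM_eq_Adem {T C' C'' D' D'' e S r : ℝ} (hT : 0 < T) (he : e < r + T + D'')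
    (hS : S < r + T + T) : DEM T C' C'' D' D'' e S r = Adem C' C'' D' D'' e S r := by
  unfold DEM
  split_ifs with h
  · rfl
  · have hfloor : ⌊(S - r - T) / T⌋ = 0 := by
      rw [Int.floor_eq_zero_iff]
      constructor
      · exact div_nonneg (by linarith) hT.le
      · rw [div_lt_one hT]; linarith
    have hB : ¬ r + T + D'' ≤ e := by linarith
    simp [hfloor, Bdem, hB]

/-- When the carry-over job is released one period before the switch into level-(m−1) mode, the
next job contributes all the demand it can. -/
theorem min_le_DEM_neg_period {T C' C'' D' D'' e S : ℝ} (hT : 0 < T) (hC' : 0 ≤ C')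
    (hC : C' ≤ C'') (hS : 0 ≤ S) (hST : S ≤ T) (he : e = D'') :
    min C'' S ≤ DEM T C' C'' D' D'' e S (-T) := by
  have hA : 0 ≤ Adem C' C'' D' D'' e S (-T) := Adem_nonneg hC hC' hS
  rw [DEM, if_neg (by linarith), show S - -T - T = S by ring]
  rcases hST.lt_or_eq with h | rfl
  · have hfloor : ⌊S / T⌋ = 0 := by
      rw [Int.floor_eq_zero_iff]
      exact ⟨div_nonneg hS hT.le, (div_lt_one hT).2 h⟩
    simp [hfloor, Bdem, he] at hA ⊢
    simpa using hA
  · have hB : ¬ -S + (1 + 1) * S + D'' ≤ e := by linarith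
    simp only [div_self hT.ne', Int.floor_one, Int.cast_one, Bdem, if_neg hB]
    linarith [min_le_left C'' S]

/-- Case C1 of the level-(m−1) maximum demand pattern: if `e ≤ D''`, the demand
is maximized by aligning the carry-over job's level-(m−1) virtual deadline with
the end of the interval, i.e. `r = ((e − D'') mod T) − T`. -/
theorem max_demand_pattern_level_m_minus_one_case_C1
    (T C' C'' D' D'' e S : ℝ)
    (hT : 0 < T) (hC' : 0 < C') (hC'C'' : C' ≤ C'')
    (hC'D' : C' ≤ D') (hC''D'' : C'' ≤ D'')
    (hD'D'' : D' ≤ D'') (hD''T : D'' ≤ T)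
    (hS0 : 0 ≤ S) (hSe : S ≤ e)
    (heD'' : e ≤ D'') :
    ∀ r : ℝ, -T ≤ r → r ≤ 0 →
      DEM T C' C'' D' D'' e S r ≤
        DEM T C' C'' D' D'' e S (rmod (e - D'') T - T) := by
  intro r hr _
  rcases heD''.lt_or_eq with h | h
  · rw [rmod_eq_add_of_neg (by linarith) (by linarith), add_sub_cancel_right,
      DEM_eq_Adem hT (by linarith) (by linarith), DEM_eq_Adem hT (by linarith) (by linarith)]
    exact Adem_le_Adem_aligned hC'C'' hC'.le hS0
  · have hstar : rmod (e - D'') T - T = -T := by simp [rmod, h]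
    rw [hstar]
    rcases hr.lt_or_eq with hlt | rfl
    · rw [DEM_eq_Adem hT (by linarith) (by linarith)]
      exact (Adem_le_min (by linarith) hS0).trans
        (min_le_DEM_neg_period hT hC'.le hC'C'' hS0 (by linarith) h)
    · exact le_rfl
end

section
/- (Case C3 of the level-(m−1) maximum demand pattern.) Suppose e > D'', S > C'', and, setting r₁ = C' − D', suppose r₁ + T ≤ S and r₁ + (n₁ + 1)·T + D'' ≤ e where n₁ = ⌊(S − r₁ − T)/T⌋ (i.e., in the release pattern starting at r₁, the last job released before the level-m mode switch still has its level-(m−1) virtual deadline within the interval). Then for every r ∈ [−T, 0], DEM(r) ≤ DEM(r₁). -/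
theorem Adem_le (C' C'' D' D'' e S r : ℝ) (hC'' : 0 ≤ C'') :
    Adem C' C'' D' D'' e S r ≤ C'' := by
  unfold Adem
  split_ifs
  · have h₁ := min_le_left (min (r + D') C' + C'' - C') S
    have h₂ := min_le_right (r + D') C'
    linarith
  · exact hC''

theorem Adem_le_zero_or_le_sub (C' C'' D' D'' e S r : ℝ) :
    Adem C' C'' D' D'' e S r ≤ 0 ∨ Adem C' C'' D' D'' e S r ≤ C'' - (C' - D' - r) := by
  unfold Adem
  split_ifs
  · right
    have h₁ := min_le_left (min (r + D') C' + C'' - C') S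
    have h₂ := min_le_left (r + D') C'
    linarith
  · exact Or.inl le_rfl

theorem Adem_start (C' C'' D' D'' e S : ℝ) (hC' : 0 ≤ C') (hC'D' : C' ≤ D')
    (heD'' : D'' ≤ e) (hSC'' : C'' ≤ S) :
    Adem C' C'' D' D'' e S (C' - D') = C'' := by
  unfold Adem
  rw [if_pos ⟨by linarith, by linarith⟩]
  simp [hSC'']

theorem Bdem_le (C'' D'' e S s : ℝ) (hC'' : 0 ≤ C'') (hs : s ≤ S) :
    Bdem C'' D'' e S s ≤ min C'' (S - s) := by
  unfold Bdem
  split_ifs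
  · exact le_rfl
  · exact le_min hC'' (by linarith)

theorem floor_div_mul_bounds {T : ℝ} (hT : 0 < T) (x : ℝ) :
    (⌊x / T⌋ : ℝ) * T ≤ x ∧ x < ((⌊x / T⌋ : ℝ) + 1) * T :=
  ⟨(le_div_iff₀ hT).1 (Int.floor_le _), (div_lt_iff₀ hT).1 (Int.lt_floor_add_one _)⟩

/-- Case C3 of the level-(m−1) maximum demand pattern: if `e > D''`, `S > C''`,
and, with `r₁ = C' − D'` and `n₁ = ⌊(S − r₁ − T)/T⌋`, we have `r₁ + T ≤ S` and
`r₁ + (n₁ + 1)·T + D'' ≤ e`, then the demand is maximized at `r = r₁`. -/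
theorem max_demand_pattern_level_m_minus_one_case_C3
    (T C' C'' D' D'' e S : ℝ)
    (hT : 0 < T) (hC' : 0 < C') (hC'C'' : C' ≤ C'')
    (hC'D' : C' ≤ D') (hC''D'' : C'' ≤ D'')
    (hD'D'' : D' ≤ D'') (hD''T : D'' ≤ T)
    (hS0 : 0 ≤ S) (hSe : S ≤ e)
    (heD'' : D'' < e) (hSC'' : C'' < S)
    (hr1 : (C' - D') + T ≤ S)
    (hlast : (C' - D') + (((⌊(S - (C' - D') - T) / T⌋ : ℤ) : ℝ) + 1) * T + D'' ≤ e) :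
    ∀ r : ℝ, -T ≤ r → r ≤ 0 →
      DEM T C' C'' D' D'' e S r ≤ DEM T C' C'' D' D'' e S (C' - D') := by
  intro r hrT hr0
  have hC''0 : 0 ≤ C'' := hC'.le.trans hC'C''
  have hA := Adem_le C' C'' D' D'' e S r hC''0
  have hA' := Adem_le_zero_or_le_sub C' C'' D' D'' e S r
  obtain ⟨hn₁, hn₁'⟩ := floor_div_mul_bounds hT (S - (C' - D') - T)
  have hn₁0 : 0 ≤ ⌊(S - (C' - D') - T) / T⌋ :=
    Int.floor_nonneg.2 (div_nonneg (by linarith) hT.le)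
  unfold DEM
  rw [if_neg (not_lt.2 hr1), Adem_start C' C'' D' D'' e S hC'.le hC'D' heD''.le hSC''.le]
  rw [show Bdem C'' D'' e S (C' - D' + _) = _ from if_pos hlast]
  generalize ⌊(S - (C' - D') - T) / T⌋ = n₁ at *
  generalize Adem C' C'' D' D'' e S r = A at *
  have hn₁0' : (0 : ℝ) ≤ n₁ := by exact_mod_cast hn₁0
  have hw : 0 ≤ min C'' (S - (C' - D' + (n₁ + 1) * T)) := le_min hC''0 (by linarith)
  split_ifs with hrS
  · nlinarith [mul_nonneg hn₁0' hC''0]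
  obtain ⟨hn, hn'⟩ := floor_div_mul_bounds hT (S - r - T)
  have hB := Bdem_le C'' D'' e S (r + ((⌊(S - r - T) / T⌋ : ℝ) + 1) * T) hC''0 (by linarith)
  generalize ⌊(S - r - T) / T⌋ = n at *
  generalize Bdem C'' D'' e S _ = B at *
  obtain ⟨hB₁, hB₂⟩ := le_min_iff.1 hB
  have hn_le : n ≤ n₁ + 1 := by
    have : (n : ℝ) < n₁ + 2 := lt_of_mul_lt_mul_right (a := T) (by linarith) hT.le
    have : n < n₁ + 2 := by exact_mod_cast this
    omega
  rcases lt_trichotomy n n₁ with h | rfl | h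
  · have h' : (n : ℝ) + 1 ≤ n₁ := by exact_mod_cast h
    nlinarith [mul_le_mul_of_nonneg_right h' hC''0]
  · have : A + B - C'' ≤ min C'' (S - (C' - D' + (n + 1) * T)) := by
      apply le_min
      · linarith
      · rcases hA' with h | h <;> linarith
    linarith
  · obtain rfl : n = n₁ + 1 := by omega
    push_cast at *
    have : A + B ≤ min C'' (S - (C' - D' + (n₁ + 1) * T)) := by
      apply le_min <;> rcases hA' with h | h <;> linarith
    linarith
end

section
/- (Pseudo-polynomial bound on interval lengths for the classical demand bound test.) Consider a finite set of constrained-deadline sporadic tasks, task i having minimum inter-release separation T_i, worst-case execution time C_i, and relative deadline D_i with 0 < C_i ≤ D_i ≤ T_i, and demand bound function dbf_i(e) = max(0, ⌊(e − D_i)/T_i⌋ + 1) · C_i. If the total utilization U = Σ_i C_i/T_i satisfies U < 1, then every real e ≥ 0 with Σ_i dbf_i(e) > e satisfies e < ( Σ_i C_i · (T_i − D_i)/T_i ) / (1 − U); hence the demand-bound schedulability condition need only be checked for interval lengths up to this bound. -/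
/-- The classical demand bound function of a constrained-deadline sporadic task
with minimum inter-release separation `T`, worst-case execution time `C` and
relative deadline `D`: `dbf(e) = max(0, ⌊(e − D)/T⌋ + 1) · C`. -/
noncomputable def dbf (T C D e : ℝ) : ℝ :=
  ((max 0 (⌊(e - D) / T⌋ + 1) : ℤ) : ℝ) * C

/-- A constrained-deadline task demands at most `C·(T − D)/T` plus its utilization times `e`. -/
theorem dbf_le_add_mul_utilization {T C D e : ℝ} (hT : 0 < T) (hC : 0 ≤ C) (hDT : D ≤ T)
    (he : 0 ≤ e) : dbf T C D e ≤ C * (T - D) / T + C / T * e := by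
  have hlinear : C * (T - D) / T + C / T * e = ((e - D) / T + 1) * C := by
    field_simp
    ring
  have hnonneg : 0 ≤ (e - D) / T + 1 := by
    rw [div_add_one hT.ne']
    exact div_nonneg (by linarith) hT.le
  rw [hlinear, dbf]
  gcongr
  push_cast
  exact max_le hnonneg (by gcongr; exact Int.floor_le _)

/-- Pseudo-polynomial bound on interval lengths for the classical demand bound
test: if the total utilization `U = Σᵢ Cᵢ/Tᵢ` is below 1, then any interval
length `e ≥ 0` with `Σᵢ dbfᵢ(e) > e` satisfies
`e < (Σᵢ Cᵢ·(Tᵢ − Dᵢ)/Tᵢ) / (1 − U)`. -/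
theorem classical_dbf_test_pseudo_polynomial_bound
    {ι : Type} [Fintype ι] (T C D : ι → ℝ)
    (h : ∀ i, 0 < C i ∧ C i ≤ D i ∧ D i ≤ T i)
    (hU : (∑ i, C i / T i) < 1) :
    ∀ e : ℝ, 0 ≤ e →
      (∑ i, dbf (T i) (C i) (D i) e) > e →
      e < (∑ i, C i * (T i - D i) / T i) / (1 - ∑ i, C i / T i) := by
  intro e he hdemand
  have hbound : ∑ i, dbf (T i) (C i) (D i) e ≤
      ∑ i, C i * (T i - D i) / T i + (∑ i, C i / T i) * e := by
    rw [Finset.sum_mul, ← Finset.sum_add_distrib]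
    refine Finset.sum_le_sum fun i _ => ?_
    obtain ⟨hC, hCD, hDT⟩ := h i
    exact dbf_le_add_mul_utilization (by linarith) hC.le hDT he
  rw [lt_div_iff₀ (sub_pos.mpr hU)]
  linarith
end
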